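/- Let n ≥ 5 be an integer. The infimum, over all functions u : ℝⁿ → ℝ of class C² with compact support contained in ℝⁿ \ {0} and with ∫_{ℝⁿ} |x|^{-2} |∇u(x)|² dx ≠ 0, of the quotient (∫_{ℝⁿ} |Δu(x)|² dx) / (∫_{ℝⁿ} |x|^{-2} |∇u(x)|² dx) equals n²/4. In particular ∫_{ℝⁿ} |Δu|² dx ≥ (n²/4) ∫_{ℝⁿ} |x|^{-2} |∇u|² dx for all such u, and n²/4 is the best constant. -/

import Mathlib

open MeasureTheory

noncomputable def lap {n : ℕ} (u : EuclideanSpace ℝ (Fin n) → ℝ)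
    (x : EuclideanSpace ℝ (Fin n)) : ℝ :=
  ∑ i : Fin n, iteratedFDeriv ℝ 2 u x ![EuclideanSpace.single i 1, EuclideanSpace.single i 1]

open Filter Topology Set

section Punctured

variable {n : ℕ}

/-- `f` is of class `C^m` with compact support in the punctured space. -/
structure PuncturedTest (m : WithTop ℕ∞) (f : EuclideanSpace ℝ (Fin n) → ℝ) : Prop where
  smooth : ContDiff ℝ m f
  compact : HasCompactSupport f
  zero_notMem : (0 : EuclideanSpace ℝ (Fin n)) ∉ tsupport f

/-- The `i`-th partial derivative. -/
noncomputable def partialD (i : Fin n) (f : EuclideanSpace ℝ (Fin n) → ℝ)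
    (x : EuclideanSpace ℝ (Fin n)) : ℝ :=
  fderiv ℝ f x (EuclideanSpace.single i 1)

/-- The weight `|x|⁻²`. -/
noncomputable def invSq (x : EuclideanSpace ℝ (Fin n)) : ℝ := (‖x‖ ^ 2)⁻¹

namespace PuncturedTest

variable {m k : WithTop ℕ∞} {f g : EuclideanSpace ℝ (Fin n) → ℝ}

theorem of_le (hf : PuncturedTest m f) (h : k ≤ m) : PuncturedTest k f :=
  ⟨hf.smooth.of_le h, hf.compact, hf.zero_notMem⟩

theorem continuous (hf : PuncturedTest m f) : Continuous f := hf.smooth.continuous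

theorem integrable (hf : PuncturedTest m f) : Integrable f :=
  hf.continuous.integrable_of_hasCompactSupport hf.compact

theorem weight_mul (hf : PuncturedTest m f) (hg : ∀ x ≠ 0, ContDiffAt ℝ m g x) :
    PuncturedTest m (fun x => g x * f x) := by
  refine ⟨contDiff_iff_contDiffAt.2 fun x => ?_, hf.compact.mul_left,
    fun h => hf.zero_notMem (tsupport_mul_subset_right h)⟩
  by_cases hx : x = 0
  · subst hx
    have h0 : f =ᶠ[𝓝 0] 0 := notMem_tsupport_iff_eventuallyEq.1 hf.zero_notMem
    have h1 : (fun x => g x * f x) =ᶠ[𝓝 0] fun _ => 0 := by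
      filter_upwards [h0] with y hy
      simp [hy]
    exact contDiffAt_const.congr_of_eventuallyEq h1
  · exact (hg x hx).mul hf.smooth.contDiffAt

theorem mul_of_contDiff (hf : PuncturedTest m f) (hg : ContDiff ℝ m g) :
    PuncturedTest m (fun x => g x * f x) :=
  hf.weight_mul fun _ _ => hg.contDiffAt

theorem mul (hf : PuncturedTest m f) (hg : PuncturedTest m g) :
    PuncturedTest m (fun x => f x * g x) :=
  hg.mul_of_contDiff hf.smooth

theorem sq (hf : PuncturedTest m f) : PuncturedTest m (fun x => f x ^ 2) := by
  simpa only [_root_.sq] using hf.mul hf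

theorem zero : PuncturedTest m (fun _ : EuclideanSpace ℝ (Fin n) => (0 : ℝ)) :=
  ⟨contDiff_const, HasCompactSupport.zero, by
    have : tsupport (fun _ : EuclideanSpace ℝ (Fin n) => (0 : ℝ)) = ∅ :=
      tsupport_eq_empty_iff.2 rfl
    simp [this]⟩

theorem add (hf : PuncturedTest m f) (hg : PuncturedTest m g) :
    PuncturedTest m (fun x => f x + g x) :=
  ⟨hf.smooth.add hg.smooth, hf.compact.add hg.compact,
    fun h => (tsupport_add f g h).elim hf.zero_notMem hg.zero_notMem⟩

theorem sum {ι : Type*} {F : ι → EuclideanSpace ℝ (Fin n) → ℝ} (s : Finset ι)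
    (hF : ∀ i, PuncturedTest m (F i)) : PuncturedTest m (fun x => ∑ i ∈ s, F i x) := by
  classical
  induction s using Finset.induction_on with
  | empty => simpa using zero
  | insert a s ha ih =>
    simp only [Finset.sum_insert ha]
    exact (hF a).add ih

theorem partialD (hf : PuncturedTest (m + 1) f) (i : Fin n) : PuncturedTest m (partialD i f) :=
  ⟨(hf.smooth.fderiv_right le_rfl).clm_apply contDiff_const,
    hf.compact.fderiv_apply ℝ _,
    fun h => hf.zero_notMem (tsupport_fderiv_apply_subset ℝ _ h)⟩

end PuncturedTest

theorem contDiff_coord {m : WithTop ℕ∞} (i : Fin n) :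
    ContDiff ℝ m (fun x : EuclideanSpace ℝ (Fin n) => x i) :=
  (EuclideanSpace.proj (𝕜 := ℝ) i).contDiff

theorem contDiffAt_invSq {m : WithTop ℕ∞} {x : EuclideanSpace ℝ (Fin n)} (hx : x ≠ 0) :
    ContDiffAt ℝ m invSq x :=
  (contDiff_norm_sq ℝ).contDiffAt.inv (by simpa using hx)

theorem PuncturedTest.invSq_mul {m : WithTop ℕ∞} {f : EuclideanSpace ℝ (Fin n) → ℝ}
    (hf : PuncturedTest m f) : PuncturedTest m (fun x => invSq x * f x) :=
  hf.weight_mul fun _ hx => contDiffAt_invSq hx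

theorem PuncturedTest.coord_mul {m : WithTop ℕ∞} {f : EuclideanSpace ℝ (Fin n) → ℝ}
    (hf : PuncturedTest m f) (i : Fin n) : PuncturedTest m (fun x => x i * f x) :=
  hf.mul_of_contDiff (contDiff_coord i)

theorem partialD_coord (i j : Fin n) (x : EuclideanSpace ℝ (Fin n)) :
    partialD i (fun y => y j) x = if j = i then 1 else 0 := by
  have : HasFDerivAt (fun y : EuclideanSpace ℝ (Fin n) => y j)
    (EuclideanSpace.proj (𝕜 := ℝ) j) x := (EuclideanSpace.proj (𝕜 := ℝ) j).hasFDerivAt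
  rw [partialD, this.fderiv]
  simp

theorem partialD_mul {f g : EuclideanSpace ℝ (Fin n) → ℝ} {x : EuclideanSpace ℝ (Fin n)}
    (hf : DifferentiableAt ℝ f x) (hg : DifferentiableAt ℝ g x) (i : Fin n) :
    partialD i (fun y => f y * g y) x = partialD i f x * g x + f x * partialD i g x := by
  simp only [partialD]
  rw [fderiv_fun_mul hf hg]
  simp
  ring

theorem partialD_sum {ι : Type*} {s : Finset ι} {F : ι → EuclideanSpace ℝ (Fin n) → ℝ}
    {x : EuclideanSpace ℝ (Fin n)} (hF : ∀ j ∈ s, DifferentiableAt ℝ (F j) x) (i : Fin n) :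
    partialD i (fun y => ∑ j ∈ s, F j y) x = ∑ j ∈ s, partialD i (F j) x := by
  simp only [partialD]
  rw [fderiv_fun_sum hF]
  simp

theorem partialD_invSq {x : EuclideanSpace ℝ (Fin n)} (hx : x ≠ 0) (i : Fin n) :
    partialD i invSq x = -2 * x i * invSq x ^ 2 := by
  have h1 : HasFDerivAt (fun y : EuclideanSpace ℝ (Fin n) => ‖y‖ ^ 2) (2 • innerSL ℝ x) x :=
    (hasStrictFDerivAt_norm_sq x).hasFDerivAt
  have h3 : HasFDerivAt invSq (-((‖x‖ ^ 2) ^ 2)⁻¹ • (2 • innerSL ℝ x)) x :=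
    (hasDerivAt_inv (by simpa using hx)).comp_hasFDerivAt x h1
  rw [partialD, h3.fderiv]
  simp [invSq, EuclideanSpace.inner_single_right]
  ring

theorem sum_coord_sq (x : EuclideanSpace ℝ (Fin n)) : ∑ i, x i ^ 2 = ‖x‖ ^ 2 := by
  rw [EuclideanSpace.norm_sq_eq]
  simp

theorem invSq_mul_sum_coord_sq {x : EuclideanSpace ℝ (Fin n)} (hx : x ≠ 0) :
    invSq x * ∑ i, x i ^ 2 = 1 := by
  rw [sum_coord_sq, invSq, inv_mul_cancel₀]
  simpa using hx

theorem integral_partialD {f : EuclideanSpace ℝ (Fin n) → ℝ} (hf : PuncturedTest 1 f)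
    (i : Fin n) : ∫ x, partialD i f x = 0 := by
  have h := integral_mul_fderiv_eq_neg_fderiv_mul_of_integrable (μ := volume)
    (f := fun _ : EuclideanSpace ℝ (Fin n) => (1 : ℝ)) (g := f)
    (v := EuclideanSpace.single i 1) (by simp)
    (by simpa using! (PuncturedTest.partialD (m := 0) (by simpa using hf) i).integrable)
    (by simpa using hf.integrable)
    (by simp) (fun x _ => hf.smooth.differentiable (by simp) x)
  simpa [partialD] using h

theorem integral_partialD_mul_partialD_comm {f g : EuclideanSpace ℝ (Fin n) → ℝ}
    (hf : PuncturedTest 1 f) (hg : PuncturedTest 1 g) (i j : Fin n) :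
    ∫ x, partialD i f x * partialD j g x = ∫ x, partialD j f x * partialD i g x := by
  obtain ⟨C, hC⟩ := hf.smooth.lipschitzWith_of_hasCompactSupport hf.compact (by simp)
  obtain ⟨D, hD⟩ := hg.smooth.lipschitzWith_of_hasCompactSupport hg.compact (by simp)
  have df := hf.smooth.differentiable (by simp)
  have dg := hg.smooth.differentiable (by simp)
  have hf' : ∀ l, PuncturedTest 0 (partialD l f) := fun l => PuncturedTest.partialD (by simpa) l
  have hg' : ∀ l, PuncturedTest 0 (partialD l g) := fun l => PuncturedTest.partialD (by simpa) l
  set e : EuclideanSpace ℝ (Fin n) := EuclideanSpace.single i 1 with he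
  have A := LipschitzWith.integral_inv_smul_sub_mul_tendsto_integral_lineDeriv_mul
    (μ := volume) hC (hg' j).integrable e
  have B := LipschitzWith.integral_inv_smul_sub_mul_tendsto_integral_lineDeriv_mul
    (μ := volume) hD (hf' j).integrable (-e)
  have key : ∀ t : ℝ, ∫ x, (t⁻¹ • (f (x + t • e) - f x)) * partialD j g x =
      - ∫ x, (t⁻¹ • (g (x + t • (-e)) - g x)) * partialD j f x := by
    intro t
    have shiftf : ∀ x, partialD j (fun y => f (y + t • e)) x = partialD j f (x + t • e) := by
      intro x
      simp only [partialD, fderiv_comp_add_right]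
    have dsh : Differentiable ℝ (fun y => f (y + t • e)) := by fun_prop
    have csh : Continuous (fun y => partialD j f (y + t • e)) :=
      (hf' j).continuous.comp (continuous_id.add continuous_const)
    have fsh : Continuous (fun y => f (y + t • e)) :=
      hf.continuous.comp (continuous_id.add continuous_const)
    have gsh : Continuous (fun y => g (y + t • (-e))) :=
      hg.continuous.comp (continuous_id.add continuous_const)
    have int1 : ∀ u v : EuclideanSpace ℝ (Fin n) → ℝ, Continuous u → Continuous v →
        HasCompactSupport v → Integrable (fun x => u x * v x) := fun u v hu hv h =>
      (hu.mul hv).integrable_of_hasCompactSupport h.mul_left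
    have ibp : ∀ u : EuclideanSpace ℝ (Fin n) → ℝ, Differentiable ℝ u →
        Continuous (partialD j u) →
        ∫ x, u x * partialD j g x = - ∫ x, partialD j u x * g x := by
      intro u hu hu'
      exact integral_mul_fderiv_eq_neg_fderiv_mul_of_integrable
        (int1 _ _ hu' hg.continuous hg.compact)
        (int1 _ _ hu.continuous (hg' j).continuous (hg' j).compact)
        (int1 _ _ hu.continuous hg.continuous hg.compact)
        (fun x _ => hu x) (fun x _ => dg x)
    have i1 := ibp (fun y => f (y + t • e)) dsh (by simpa only [funext shiftf] using csh)
    have i2 := ibp f df (hf' j).continuous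
    simp only [shiftf] at i1
    have i3 : ∫ x, partialD j f (x + t • e) * g x = ∫ x, g (x + t • (-e)) * partialD j f x := by
      rw [← integral_add_right_eq_self _ (t • (-e))]
      congr 1
      ext x
      simp [mul_comm]
    have i4 : ∫ x, (f (x + t • e) - f x) * partialD j g x =
        - ∫ x, (g (x + t • (-e)) - g x) * partialD j f x := by
      simp only [sub_mul]
      rw [integral_sub (int1 _ _ fsh (hg' j).continuous (hg' j).compact)
        (int1 _ _ hf.continuous (hg' j).continuous (hg' j).compact), integral_sub
        (int1 _ _ gsh (hf' j).continuous (hf' j).compact)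
        (int1 _ _ hg.continuous (hf' j).continuous (hf' j).compact), i1, i2, i3]
      simp only [mul_comm (partialD j f _)]
      ring
    simp only [smul_eq_mul, mul_assoc, integral_const_mul, i4]
    ring
  simp only [key] at A
  have := tendsto_nhds_unique A B.neg
  simp only [lineDeriv_neg, fun x => (df x).lineDeriv_eq_fderiv (v := e),
    fun x => (dg x).lineDeriv_eq_fderiv (v := e), neg_mul, integral_neg, neg_neg] at this
  simp only [mul_comm (partialD j f _)]
  exact this

theorem ae_ne_zero (hn : n ≠ 0) : ∀ᵐ x : EuclideanSpace ℝ (Fin n), x ≠ 0 := by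
  have : Nonempty (Fin n) := ⟨⟨0, Nat.pos_of_ne_zero hn⟩⟩
  exact MeasureTheory.compl_mem_ae_iff.2 (measure_singleton 0)

theorem partialD_partialD {u : EuclideanSpace ℝ (Fin n) → ℝ} (hu : ContDiff ℝ 2 u) (i j : Fin n)
    (x : EuclideanSpace ℝ (Fin n)) :
    partialD i (partialD j u) x =
      fderiv ℝ (fderiv ℝ u) x (EuclideanSpace.single i 1) (EuclideanSpace.single j 1) := by
  have h : DifferentiableAt ℝ (fderiv ℝ u) x :=
    (hu.fderiv_right (m := 1) (by norm_num)).differentiable (by simp) x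
  have h2 : HasFDerivAt (partialD j u)
      ((fderiv ℝ (fderiv ℝ u) x).flip (EuclideanSpace.single j 1)) x := by
    have := h.hasFDerivAt.clm_apply (hasFDerivAt_const (EuclideanSpace.single j (1 : ℝ)) x)
    simpa using! this
  rw [partialD, h2.fderiv]
  rfl

theorem partialD_comm {u : EuclideanSpace ℝ (Fin n) → ℝ} (hu : ContDiff ℝ 2 u) (i j : Fin n)
    (x : EuclideanSpace ℝ (Fin n)) :
    partialD i (partialD j u) x = partialD j (partialD i u) x := by
  rw [partialD_partialD hu, partialD_partialD hu]
  exact hu.contDiffAt.isSymmSndFDerivAt (by simp) _ _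

theorem lap_eq_sum {u : EuclideanSpace ℝ (Fin n) → ℝ} (hu : ContDiff ℝ 2 u)
    (x : EuclideanSpace ℝ (Fin n)) : lap u x = ∑ i, partialD i (partialD i u) x := by
  simp [lap, iteratedFDeriv_two_apply, partialD_partialD hu]

/-- The Euler field `x · ∇f`. -/
noncomputable def eulerD (f : EuclideanSpace ℝ (Fin n) → ℝ) (x : EuclideanSpace ℝ (Fin n)) : ℝ :=
  ∑ i, x i * partialD i f x

/-- The pointwise product `∇f · ∇g`. -/
noncomputable def gradDot (f g : EuclideanSpace ℝ (Fin n) → ℝ) (x : EuclideanSpace ℝ (Fin n)) :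
    ℝ :=
  ∑ i, partialD i f x * partialD i g x

theorem norm_gradient_sq (u : EuclideanSpace ℝ (Fin n) → ℝ) (x : EuclideanSpace ℝ (Fin n)) :
    ‖gradient u x‖ ^ 2 = gradDot u u x := by
  rw [EuclideanSpace.norm_sq_eq, gradDot]
  refine Finset.sum_congr rfl fun i _ => ?_
  have : gradient u x i = partialD i u x := by
    rw [partialD, ← InnerProductSpace.toDual_symm_apply (𝕜 := ℝ) (E := EuclideanSpace ℝ (Fin n))]
    simp [gradient, EuclideanSpace.inner_single_right, -InnerProductSpace.toDual_symm_apply]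
  rw [this, Real.norm_eq_abs, sq_abs, sq]

section Regularity

variable {m : WithTop ℕ∞} {f g : EuclideanSpace ℝ (Fin n) → ℝ}

theorem PuncturedTest.eulerD (hf : PuncturedTest (m + 1) f) : PuncturedTest m (eulerD f) :=
  PuncturedTest.sum _ fun i => (hf.partialD i).coord_mul i

theorem PuncturedTest.gradDot (hf : PuncturedTest (m + 1) f) (hg : PuncturedTest (m + 1) g) :
    PuncturedTest m (gradDot f g) :=
  PuncturedTest.sum _ fun i => (hf.partialD i).mul (hg.partialD i)

theorem PuncturedTest.lap (hf : PuncturedTest 2 f) : PuncturedTest 0 (lap f) := by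
  rw [funext (lap_eq_sum hf.smooth)]
  refine PuncturedTest.sum _ fun i => PuncturedTest.partialD ?_ i
  exact PuncturedTest.partialD (hf.of_le (by norm_num)) i

theorem PuncturedTest.differentiable (hf : PuncturedTest 1 f) : Differentiable ℝ f :=
  hf.smooth.differentiable (by simp)

end Regularity

theorem differentiableAt_coord (i : Fin n) (x : EuclideanSpace ℝ (Fin n)) :
    DifferentiableAt ℝ (fun y : EuclideanSpace ℝ (Fin n) => y i) x :=
  (contDiff_coord (m := 1) i).differentiable (by simp) x

theorem differentiableAt_invSq {x : EuclideanSpace ℝ (Fin n)} (hx : x ≠ 0) :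
    DifferentiableAt ℝ invSq x :=
  (contDiffAt_invSq (m := 1) hx).differentiableAt (by simp)

theorem partialD_invSq_pow {x : EuclideanSpace ℝ (Fin n)} (hx : x ≠ 0) (k : ℕ) (i : Fin n) :
    partialD i (fun y => invSq y ^ k) x = -2 * k * x i * invSq x ^ (k + 1) := by
  induction k with
  | zero => simp [partialD]
  | succ k ih =>
    simp only [pow_succ _ k]
    rw [partialD_mul ((differentiableAt_invSq hx).fun_pow k) (differentiableAt_invSq hx), ih,
      partialD_invSq hx]
    push_cast
    ring

theorem partialD_eulerD {u : EuclideanSpace ℝ (Fin n) → ℝ} (hu : PuncturedTest 2 u) (j : Fin n)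
    (x : EuclideanSpace ℝ (Fin n)) :
    partialD j (eulerD u) x = partialD j u x + ∑ i, x i * partialD j (partialD i u) x := by
  have hp : ∀ i, DifferentiableAt ℝ (partialD i u) x := fun i =>
    (PuncturedTest.partialD (m := 1) (hu.of_le (by norm_num)) i).differentiable x
  have : eulerD u = fun y => ∑ i, y i * partialD i u y := rfl
  rw [this, partialD_sum fun i _ => (differentiableAt_coord i x).fun_mul (hp i)]
  simp only [partialD_mul (differentiableAt_coord _ x) (hp _), partialD_coord,
    Finset.sum_add_distrib]
  simp

theorem eulerD_sq {f : EuclideanSpace ℝ (Fin n) → ℝ} (hf : PuncturedTest 1 f)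
    (x : EuclideanSpace ℝ (Fin n)) : eulerD (fun y => f y ^ 2) x = 2 * (f x * eulerD f x) := by
  have h := hf.differentiable x
  simp only [eulerD, sq, partialD_mul h h, Finset.mul_sum]
  exact Finset.sum_congr rfl fun i _ => by ring

theorem eulerD_gradDot_self {u : EuclideanSpace ℝ (Fin n) → ℝ} (hu : PuncturedTest 2 u)
    (x : EuclideanSpace ℝ (Fin n)) :
    eulerD (gradDot u u) x = 2 * gradDot (eulerD u) u x - 2 * gradDot u u x := by
  have hp : ∀ i, DifferentiableAt ℝ (partialD i u) x := fun i =>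
    (PuncturedTest.partialD (m := 1) (hu.of_le (by norm_num)) i).differentiable x
  have h1 : ∀ i, partialD i (gradDot u u) x =
      ∑ j, 2 * (partialD i (partialD j u) x * partialD j u x) := by
    intro i
    have : gradDot u u = fun y => ∑ j, partialD j u y * partialD j u y := rfl
    rw [this, partialD_sum fun i _ => (hp i).fun_mul (hp i)]
    refine Finset.sum_congr rfl fun j _ => ?_
    rw [partialD_mul (hp _) (hp _)]
    ring
  rw [eulerD, gradDot, gradDot]
  simp only [h1, partialD_eulerD hu, add_mul, Finset.sum_add_distrib, Finset.mul_sum,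
    Finset.sum_mul]
  rw [Finset.sum_comm, ← sub_eq_zero]
  have h2 : ∀ i j, partialD j (partialD i u) x = partialD i (partialD j u) x := fun i j =>
    partialD_comm hu.smooth j i x
  simp only [mul_add, Finset.mul_sum]
  rw [add_sub_cancel_left, sub_eq_zero]
  refine Finset.sum_congr rfl fun i _ => Finset.sum_congr rfl fun j _ => ?_
  rw [h2 i j]
  ring

theorem integral_comb {f g h : EuclideanSpace ℝ (Fin n) → ℝ} (hf : PuncturedTest 0 f)
    (hg : PuncturedTest 0 g) (hh : PuncturedTest 0 h) (a b c : ℝ) :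
    ∫ x, (a * f x + b * g x + c * h x) =
      a * (∫ x, f x) + b * (∫ x, g x) + c * ∫ x, h x := by
  rw [integral_add ((hf.integrable.const_mul a).fun_add (hg.integrable.const_mul b))
    (hh.integrable.const_mul c), integral_add (hf.integrable.const_mul a)
    (hg.integrable.const_mul b)]
  simp only [integral_const_mul]

/-- The divergence of a test field integrates to zero; the divergence need only be computed away
from the origin. -/
theorem integral_eq_zero_of_divergence (hn : n ≠ 0) {G : Fin n → EuclideanSpace ℝ (Fin n) → ℝ}
    (hG : ∀ i, PuncturedTest 1 (G i)) {D : EuclideanSpace ℝ (Fin n) → ℝ}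
    (hD : ∀ x ≠ 0, D x = ∑ i, partialD i (G i) x) : ∫ x, D x = 0 := by
  rw [integral_congr_ae ((ae_ne_zero hn).mono hD), integral_finsetSum _ fun i _ =>
    (PuncturedTest.partialD (m := 0) (by simpa using hG i) i).integrable]
  exact Finset.sum_eq_zero fun i _ => integral_partialD (hG i) i

theorem PuncturedTest.invSq_pow_mul {m : WithTop ℕ∞} {f : EuclideanSpace ℝ (Fin n) → ℝ}
    (hf : PuncturedTest m f) (k : ℕ) : PuncturedTest m (fun x => invSq x ^ k * f x) :=
  hf.weight_mul fun _ hx => (contDiffAt_invSq hx).pow k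

theorem integral_eulerD (hn : n ≠ 0) {f : EuclideanSpace ℝ (Fin n) → ℝ}
    (hf : PuncturedTest 1 f) (k : ℕ) :
    ∫ x, invSq x ^ k * eulerD f x = (2 * k - n) * ∫ x, invSq x ^ k * f x := by
  have h := integral_eq_zero_of_divergence hn
    (fun i => (hf.invSq_pow_mul k).coord_mul i)
    (D := fun x => 1 * (invSq x ^ k * eulerD f x) + (n - 2 * k) * (invSq x ^ k * f x) + 0 * f x) ?_
  · rw [integral_comb ((PuncturedTest.eulerD (m := 0) (by simpa using hf)).invSq_pow_mul k)
      ((hf.of_le (by simp)).invSq_pow_mul k) (hf.of_le (by simp))] at h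
    linarith
  · intro x hx
    have dw := (differentiableAt_invSq hx).fun_pow k
    have df := hf.differentiable x
    have hw := invSq_mul_sum_coord_sq hx
    have h1 : ∀ i, partialD i (fun x => x i * (invSq x ^ k * f x)) x =
        invSq x ^ k * f x - 2 * k * invSq x ^ k * f x * (invSq x * x i ^ 2)
          + invSq x ^ k * (x i * partialD i f x) := by
      intro i
      rw [partialD_mul (differentiableAt_coord i x) (dw.fun_mul df), partialD_mul dw df,
        partialD_invSq_pow hx, partialD_coord]
      simp only [if_true]
      ring
    simp only [h1, Finset.sum_add_distrib, Finset.sum_sub_distrib, ← Finset.mul_sum, hw]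
    simp [eulerD]
    ring

theorem integral_invSq_mul_lap (hn : n ≠ 0) {f u : EuclideanSpace ℝ (Fin n) → ℝ}
    (hf : PuncturedTest 1 f) (hu : PuncturedTest 2 u) :
    ∫ x, invSq x * (f x * lap u x) = -(∫ x, invSq x * gradDot f u x)
      + 2 * ∫ x, invSq x ^ 2 * (f x * eulerD u x) := by
  have hf' : PuncturedTest (0 + 1) f := by simpa using hf
  have hu' : PuncturedTest (1 + 1) u := hu.of_le (by norm_num)
  have hu1 : PuncturedTest (0 + 1) u := hu.of_le (by norm_num)
  have h := integral_eq_zero_of_divergence hn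
    (fun i => (hf.mul (hu'.partialD i)).invSq_mul)
    (D := fun x => 1 * (invSq x * (f x * lap u x)) + 1 * (invSq x * gradDot f u x)
      + (-2) * (invSq x ^ 2 * (f x * eulerD u x))) ?_
  · rw [integral_comb ((hf.of_le (by simp)).mul hu.lap).invSq_mul
      (hf'.gradDot hu1).invSq_mul
      (((hf.of_le (by simp)).mul hu1.eulerD).invSq_pow_mul 2)] at h
    linarith
  · intro x hx
    have dw := differentiableAt_invSq hx
    have df := hf.differentiable x
    have dp : ∀ i, DifferentiableAt ℝ (partialD i u) x := fun i => (hu'.partialD i).differentiable x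
    have h1 : ∀ i, partialD i (fun x => invSq x * (f x * partialD i u x)) x =
        invSq x * f x * partialD i (partialD i u) x
          + invSq x * (partialD i f x * partialD i u x)
          + (-2 * invSq x ^ 2 * f x) * (x i * partialD i u x) := by
      intro i
      rw [partialD_mul dw (df.fun_mul (dp i)), partialD_mul df (dp i), partialD_invSq hx]
      ring
    simp only [h1, Finset.sum_add_distrib, ← Finset.mul_sum, lap_eq_sum hu.smooth, eulerD,
      gradDot]
    ring

theorem integral_lap_sq {u : EuclideanSpace ℝ (Fin n) → ℝ} (hu : PuncturedTest 2 u) :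
    ∫ x, lap u x ^ 2 = ∫ x, ∑ i, ∑ j, partialD i (partialD j u) x ^ 2 := by
  have hp : ∀ i, PuncturedTest 1 (partialD i u) := fun i =>
    PuncturedTest.partialD (m := 1) (hu.of_le (by norm_num)) i
  have hH : ∀ i j, PuncturedTest 0 (partialD i (partialD j u)) := fun i j =>
    PuncturedTest.partialD (m := 0) (by simpa using hp j) i
  simp only [lap_eq_sum hu.smooth, sq, Finset.sum_mul_sum]
  rw [integral_finsetSum _ fun i _ => (PuncturedTest.sum _ fun j =>
      (hH i i).mul (hH j j)).integrable, integral_finsetSum _ fun i _ =>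
      (PuncturedTest.sum _ fun j => (hH i j).mul (hH i j)).integrable]
  refine Finset.sum_congr rfl fun i _ => ?_
  rw [integral_finsetSum _ fun j _ => ((hH i i).mul (hH j j)).integrable,
    integral_finsetSum _ fun j _ => ((hH i j).mul (hH i j)).integrable]
  refine Finset.sum_congr rfl fun j _ => ?_
  rw [integral_partialD_mul_partialD_comm (hp i) (hp j)]
  simp only [partialD_comm hu.smooth j i]

theorem integral_invSq_mul_eulerD_mul_lap (hn : n ≠ 0) {f u : EuclideanSpace ℝ (Fin n) → ℝ}
    (hf : PuncturedTest 1 f) (hu : PuncturedTest 2 u) :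
    ∫ x, invSq x * (eulerD f x * lap u x) = (∫ x, invSq x * gradDot f (eulerD u) x)
      + (n - 4) * (∫ x, invSq x * gradDot f u x)
      + 2 * ∫ x, invSq x ^ 2 * (eulerD f x * eulerD u x) := by
  have hf' : PuncturedTest (0 + 1) f := by simpa using hf
  have hu' : PuncturedTest (1 + 1) u := hu.of_le (by norm_num)
  have hu1 : PuncturedTest (0 + 1) u := hu.of_le (by norm_num)
  have hg : ∀ i j : Fin n, PuncturedTest 1 (fun x => x i * (invSq x * partialD j u x)) :=
    fun i j => (hu'.partialD j).invSq_mul.coord_mul i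
  have hI : ∀ i j k l : Fin n, Integrable fun x =>
      partialD i f x * partialD j (fun x => x k * (invSq x * partialD l u x)) x :=
    fun i j k l => ((hf'.partialD i).mul
      (PuncturedTest.partialD (m := 0) (by simpa using hg k l) j)).integrable
  have key : ∫ x, ∑ i, ∑ j, partialD i f x *
        partialD j (fun x => x i * (invSq x * partialD j u x)) x =
      ∫ x, ∑ i, ∑ j, partialD j f x *
        partialD i (fun x => x i * (invSq x * partialD j u x)) x := by
    rw [integral_finsetSum _ fun i _ => integrable_finsetSum _ fun j _ => hI _ _ _ _,
      integral_finsetSum _ fun i _ => integrable_finsetSum _ fun j _ => hI _ _ _ _]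
    refine Finset.sum_congr rfl fun i _ => ?_
    rw [integral_finsetSum _ fun j _ => hI _ _ _ _, integral_finsetSum _ fun j _ => hI _ _ _ _]
    exact Finset.sum_congr rfl fun j _ => integral_partialD_mul_partialD_comm hf (hg i j) i j
  have hd : ∀ x ≠ 0, ∀ i j k : Fin n, partialD k (fun x => x i * (invSq x * partialD j u x)) x =
      (if i = k then 1 else 0) * (invSq x * partialD j u x)
        - 2 * invSq x ^ 2 * (x i * x k * partialD j u x)
        + invSq x * (x i * partialD k (partialD j u) x) := by
    intro x hx i j k
    have dw := differentiableAt_invSq hx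
    have dp := (hu'.partialD j).differentiable x
    rw [partialD_mul (differentiableAt_coord i x) (dw.fun_mul dp), partialD_mul dw dp,
      partialD_invSq hx, partialD_coord]
    ring
  have e1 : ∀ᵐ x : EuclideanSpace ℝ (Fin n), ∑ i, ∑ j, partialD i f x *
        partialD j (fun x => x i * (invSq x * partialD j u x)) x =
      1 * (invSq x * gradDot f u x) + (-2) * (invSq x ^ 2 * (eulerD f x * eulerD u x))
        + 1 * (invSq x * (eulerD f x * lap u x)) := by
    filter_upwards [ae_ne_zero hn] with x hx
    simp only [hd x hx, lap_eq_sum hu.smooth, gradDot, eulerD, Finset.sum_mul_sum]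
    simp only [Finset.mul_sum, ← Finset.sum_add_distrib]
    refine Finset.sum_congr rfl fun i _ => ?_
    have : 1 * (invSq x * (partialD i f x * partialD i u x)) =
        ∑ j, (if i = j then 1 else 0) * (invSq x * (partialD i f x * partialD j u x)) := by
      simp
    rw [this, ← Finset.sum_add_distrib, ← Finset.sum_add_distrib]
    exact Finset.sum_congr rfl fun j _ => by ring
  have e2 : ∀ᵐ x : EuclideanSpace ℝ (Fin n), ∑ i, ∑ j, partialD j f x *
        partialD i (fun x => x i * (invSq x * partialD j u x)) x =
      (n - 3) * (invSq x * gradDot f u x) + 1 * (invSq x * gradDot f (eulerD u) x)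
        + 0 * (invSq x * gradDot f u x) := by
    filter_upwards [ae_ne_zero hn] with x hx
    have hw := invSq_mul_sum_coord_sq hx
    have hsum : ∀ j, ∑ i, partialD j f x *
        partialD i (fun x => x i * (invSq x * partialD j u x)) x =
        invSq x * (partialD j f x * ((n - 3) * partialD j u x + partialD j (eulerD u) x)) := by
      intro j
      rw [partialD_eulerD hu]
      have hi : ∀ i, partialD j f x *
          partialD i (fun x => x i * (invSq x * partialD j u x)) x =
          invSq x * partialD j f x * partialD j u x
            - 2 * invSq x * partialD j f x * partialD j u x * (invSq x * x i ^ 2)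
            + invSq x * partialD j f x * (x i * partialD j (partialD i u) x) := by
        intro i
        rw [hd x hx, partialD_comm hu.smooth j]
        simp only [if_true]
        ring
      simp only [hi, Finset.sum_add_distrib, Finset.sum_sub_distrib, ← Finset.mul_sum, hw]
      simp
      ring
    rw [Finset.sum_comm]
    simp only [hsum, gradDot, Finset.mul_sum, ← Finset.sum_add_distrib]
    exact Finset.sum_congr rfl fun j _ => by ring
  have hfe : PuncturedTest 0 (fun x => invSq x * gradDot f (eulerD u) x) :=
    (hf'.gradDot (by simpa using hu'.eulerD)).invSq_mul
  rw [integral_congr_ae e1, integral_congr_ae e2, integral_comb (hf'.gradDot hu1).invSq_mul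
    ((hf'.eulerD.mul hu1.eulerD).invSq_pow_mul 2) (hf'.eulerD.mul hu.lap).invSq_mul,
    integral_comb (hf'.gradDot hu1).invSq_mul hfe (hf'.gradDot hu1).invSq_mul] at key
  linarith

theorem sq_trace_sub_le {H : Fin n → Fin n → ℝ} (hH : ∀ i j, H i j = H j i) {x y : Fin n → ℝ}
    {w : ℝ} (hw : w * ∑ i, x i ^ 2 = 1) (hy : ∀ i, y i = ∑ j, x j * H i j) (hn : 2 ≤ n) :
    (∑ i, H i i - w * ∑ i, x i * y i) ^ 2 ≤
      (n - 1) * (∑ i, ∑ j, H i j ^ 2 - 2 * w * ∑ i, y i ^ 2 + w ^ 2 * (∑ i, x i * y i) ^ 2) := by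
  set T := ∑ i, H i i with hT
  set z := ∑ i, x i * y i with hz
  set S := ∑ i, y i ^ 2 with hS
  set s := ∑ i, x i ^ 2 with hs
  have hn1 : (0 : ℝ) < n - 1 := by
    have : (2 : ℝ) ≤ n := by exact_mod_cast hn
    linarith
  set μ := (T - w * z) / (n - 1) with hμ
  have hμ' : μ * (n - 1) = T - w * z := div_mul_cancel₀ _ hn1.ne'
  set b := (w ^ 2 * z + μ * w) / 2 with hb
  set c : Fin n → ℝ := fun i => w * y i - b * x i with hc
  have e1 : ∑ i, y i * c i = w * S - b * z := by
    simp only [hc, hS, hz, Finset.mul_sum, ← Finset.sum_sub_distrib]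
    exact Finset.sum_congr rfl fun i _ => by ring
  have e2 : ∑ i, x i * c i = w * z - b * s := by
    simp only [hc, hs, hz, Finset.mul_sum, ← Finset.sum_sub_distrib]
    exact Finset.sum_congr rfl fun i _ => by ring
  have e3 : ∑ i, c i ^ 2 = w ^ 2 * S - 2 * w * b * z + b ^ 2 * s := by
    simp only [hc, hs, hz, hS, Finset.mul_sum, ← Finset.sum_sub_distrib, ← Finset.sum_add_distrib]
    exact Finset.sum_congr rfl fun i _ => by ring
  have e4 : ∑ i, ∑ j, H i j * (c i * x j) = ∑ i, y i * c i := by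
    refine Finset.sum_congr rfl fun i _ => ?_
    rw [hy, Finset.sum_mul]
    exact Finset.sum_congr rfl fun j _ => by ring
  have e5 : ∑ i, ∑ j, H i j * (x i * c j) = ∑ i, y i * c i := by
    rw [Finset.sum_comm, ← e4]
    refine Finset.sum_congr rfl fun i _ => Finset.sum_congr rfl fun j _ => ?_
    rw [hH]
    ring
  have e6 : ∑ i, ∑ j, (x i * c j) ^ 2 = s * ∑ i, c i ^ 2 := by
    simp only [mul_pow, hs, Finset.sum_mul_sum]
  have e7 : ∑ i, ∑ j, (c i * x j) ^ 2 = s * ∑ i, c i ^ 2 := by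
    rw [mul_comm]
    simp only [mul_pow, hs, Finset.sum_mul_sum]
  have e8 : ∑ i, ∑ j, (x i * c i) * (x j * c j) = (∑ i, x i * c i) ^ 2 := by
    rw [sq, Finset.sum_mul_sum]
  have expand : ∑ i, ∑ j, (H i j - x i * c j - c i * x j - (if i = j then μ else 0)) ^ 2 =
      ∑ i, ∑ j, H i j ^ 2 - 2 * ∑ i, ∑ j, H i j * (c i * x j)
        - 2 * ∑ i, ∑ j, H i j * (x i * c j) - 2 * μ * T + ∑ i, ∑ j, (x i * c j) ^ 2
        + ∑ i, ∑ j, (c i * x j) ^ 2 + 2 * ∑ i, ∑ j, (x i * c i) * (x j * c j)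
        + 4 * μ * ∑ i, x i * c i + n * μ ^ 2 := by
    have hnμ : (n : ℝ) * μ ^ 2 = ∑ _i : Fin n, μ ^ 2 := by simp
    rw [hnμ]
    simp only [hT, Finset.mul_sum, ← Finset.sum_add_distrib, ← Finset.sum_sub_distrib]
    refine Finset.sum_congr rfl fun i _ => ?_
    have hd : ∀ j, (H i j - x i * c j - c i * x j - (if i = j then μ else 0)) ^ 2 =
        (H i j ^ 2 - 2 * (H i j * (c i * x j)) - 2 * (H i j * (x i * c j)) + (x i * c j) ^ 2
          + (c i * x j) ^ 2 + 2 * (x i * c i * (x j * c j)))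
        + if i = j then μ ^ 2 - 2 * μ * H i i + 4 * μ * (x i * c i) else 0 := by
      intro j
      split_ifs with h
      · subst h
        ring
      · ring
    simp only [hd, Finset.sum_add_distrib, Finset.sum_sub_distrib]
    simp
    ring
  have pos : 0 ≤ ∑ i, ∑ j, (H i j - x i * c j - c i * x j - (if i = j then μ else 0)) ^ 2 :=
    Finset.sum_nonneg fun i _ => Finset.sum_nonneg fun j _ => sq_nonneg _
  rw [expand, e4, e5, e6, e7, e8, e1, e2, e3] at pos
  have bs : b * s = (w * z + μ) / 2 := by
    rw [hb]
    linear_combination (w * z + μ) / 2 * hw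
  have k1 : s * (w ^ 2 * S - 2 * w * b * z + b ^ 2 * s) =
      w * S - (w * z + μ) * (w * z) + (w * z + μ) ^ 2 / 4 := by
    linear_combination (w * S) * hw + (b * s + (w * z + μ) / 2 - 2 * w * z) * bs
  rw [k1, bs] at pos
  have hbz : b * z = (w * z + μ) * (w * z) / 2 := by
    rw [hb]
    ring
  have fin : 0 ≤ ∑ i, ∑ j, H i j ^ 2 - 2 * w * S + w ^ 2 * z ^ 2 - μ ^ 2 * (n - 1) := by
    rw [hbz] at pos
    linear_combination pos + 2 * μ * hμ'
  have : (T - w * z) ^ 2 = (n - 1) * (μ ^ 2 * (n - 1)) := by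
    rw [← hμ']
    ring
  rw [this]
  exact mul_le_mul_of_nonneg_left (by linarith) hn1.le

theorem sq_mul_sum_sq_le {x : Fin n → ℝ} {w : ℝ} (hw : w * ∑ i, x i ^ 2 = 1)
    (v : Fin n → ℝ) : w ^ 2 * (∑ i, x i * v i) ^ 2 ≤ w * ∑ i, v i ^ 2 := by
  have h := mul_le_mul_of_nonneg_left (Finset.sum_mul_sq_le_sq_mul_sq Finset.univ x v)
    (sq_nonneg w)
  calc _ ≤ _ := h
    _ = w * (w * ∑ i, x i ^ 2) * ∑ i, v i ^ 2 := by ring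
    _ = _ := by rw [hw, mul_one]

theorem sum_mul_integral_nonneg {ι : Type*} [Fintype ι] (hn : n ≠ 0)
    {F : ι → EuclideanSpace ℝ (Fin n) → ℝ} (hF : ∀ k, PuncturedTest 0 (F k)) (c : ι → ℝ)
    (h : ∀ x ≠ 0, 0 ≤ ∑ k, c k * F k x) : 0 ≤ ∑ k, c k * ∫ x, F k x := by
  simp only [← integral_const_mul]
  rw [← integral_finsetSum _ fun k _ => (hF k).integrable.const_mul (c k)]
  exact integral_nonneg_of_ae ((ae_ne_zero hn).mono h)

theorem hardy_rellich (hn : 5 ≤ n) {u : EuclideanSpace ℝ (Fin n) → ℝ} (hu : PuncturedTest 2 u) :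
    (n : ℝ) ^ 2 / 4 * ∫ x, invSq x * gradDot u u x ≤ ∫ x, lap u x ^ 2 := by
  have hn0 : n ≠ 0 := by omega
  have hu' : PuncturedTest (1 + 1) u := hu.of_le (by norm_num)
  have hu1 : PuncturedTest (0 + 1) u := hu.of_le (by norm_num)
  have hq : PuncturedTest 1 (eulerD u) := hu'.eulerD
  have hq1 : PuncturedTest (0 + 1) (eulerD u) := by simpa using hq
  have hq0 : PuncturedTest 0 (eulerD u) := hq.of_le (by simp)
  have hEq : PuncturedTest 0 (eulerD (eulerD u)) := hq1.eulerD
  have hH : ∀ i j, PuncturedTest 0 (partialD i (partialD j u)) := fun i j =>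
    PuncturedTest.partialD (m := 0) (by simpa using hu'.partialD j) i
  obtain ⟨a, ha⟩ : ∃ a : ℝ, (n : ℝ) = 2 * a + 4 := ⟨(n - 4) / 2, by ring⟩
  have ha2 : 1 / 2 ≤ a := by
    have : (5 : ℝ) ≤ n := by exact_mod_cast hn
    linarith
  let F : Fin 10 → EuclideanSpace ℝ (Fin n) → ℝ :=
    ![fun x => lap u x ^ 2,
      fun x => ∑ i, ∑ j, partialD i (partialD j u) x ^ 2,
      fun x => invSq x * gradDot u u x,
      fun x => invSq x ^ 2 * eulerD u x ^ 2,
      fun x => invSq x ^ 2 * eulerD (eulerD u) x ^ 2,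
      fun x => invSq x * gradDot (eulerD u) (eulerD u) x,
      fun x => invSq x ^ 2 * (eulerD (eulerD u) x * eulerD u x),
      fun x => invSq x * gradDot (eulerD u) u x,
      fun x => invSq x * (eulerD u x * lap u x),
      fun x => invSq x * (eulerD (eulerD u) x * lap u x)]
  have hF : ∀ k, PuncturedTest 0 (F k) := by
    intro k
    fin_cases k
    · exact hu.lap.sq
    · exact PuncturedTest.sum Finset.univ fun i =>
        PuncturedTest.sum Finset.univ fun j => (hH i j).sq
    · exact (hu1.gradDot hu1).invSq_mul
    · exact hq0.sq.invSq_pow_mul 2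
    · exact hEq.sq.invSq_pow_mul 2
    · exact (hq1.gradDot hq1).invSq_mul
    · exact (hEq.mul hq0).invSq_pow_mul 2
    · exact (hq1.gradDot hu1).invSq_mul
    · exact (hq0.mul hu.lap).invSq_mul
    · exact (hEq.mul hu.lap).invSq_mul
  have hP := sum_mul_integral_nonneg hn0 hF ![-1, n - 1, -2 * (n - 1), n - 2, n - 2,
    -2 * (n - 1), -2 * (n - 2), 4 * (n - 1), -2, 2] (by
      intro x hx
      have h := sq_trace_sub_le (H := fun i j => partialD i (partialD j u) x)
        (fun i j => partialD_comm hu.smooth i j x) (x := fun i => x i)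
        (y := fun i => partialD i (eulerD u) x - partialD i u x) (invSq_mul_sum_coord_sq hx)
        (fun i => by rw [partialD_eulerD hu]; ring) (by omega)
      have hz : ∑ i, x i * (partialD i (eulerD u) x - partialD i u x) =
          eulerD (eulerD u) x - eulerD u x := by
        simp only [mul_sub, Finset.sum_sub_distrib, eulerD]
      have hS : ∑ i, (partialD i (eulerD u) x - partialD i u x) ^ 2 =
          gradDot (eulerD u) (eulerD u) x - 2 * gradDot (eulerD u) u x + gradDot u u x := by
        simp only [gradDot, Finset.mul_sum, ← Finset.sum_add_distrib, ← Finset.sum_sub_distrib]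
        exact Finset.sum_congr rfl fun i _ => by ring
      rw [← lap_eq_sum hu.smooth, hz, hS] at h
      simp [F, Fin.sum_univ_succ]
      linear_combination h)
  have hQ := sum_mul_integral_nonneg hn0 hF ![0, 0, 0, a ^ 2, 1, 0, 2 * a, 0, 0, 0] (by
      intro x hx
      have h : 0 ≤ (invSq x * (eulerD (eulerD u) x + a * eulerD u x)) ^ 2 := sq_nonneg _
      simp [F, Fin.sum_univ_succ]
      linear_combination h)
  have hR := sum_mul_integral_nonneg hn0 hF ![0, 0, a ^ 2, -a ^ 2, -1, 1, -2 * a, 2 * a, 0, 0] (by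
      intro x hx
      have h := sq_mul_sum_sq_le (invSq_mul_sum_coord_sq hx)
        (fun i => partialD i (eulerD u) x + a * partialD i u x)
      have hz : ∑ i, x i * (partialD i (eulerD u) x + a * partialD i u x) =
          eulerD (eulerD u) x + a * eulerD u x := by
        simp only [eulerD, Finset.mul_sum, ← Finset.sum_add_distrib]
        exact Finset.sum_congr rfl fun i _ => by ring
      have hS : ∑ i, (partialD i (eulerD u) x + a * partialD i u x) ^ 2 =
          gradDot (eulerD u) (eulerD u) x + 2 * a * gradDot (eulerD u) u x
            + a ^ 2 * gradDot u u x := by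
        simp only [gradDot, Finset.mul_sum, ← Finset.sum_add_distrib]
        exact Finset.sum_congr rfl fun i _ => by ring
      rw [hz, hS] at h
      simp [F, Fin.sum_univ_succ]
      linear_combination h)
  have hS := sum_mul_integral_nonneg hn0 hF ![0, 0, 1, -1, 0, 0, 0, 0, 0, 0] (by
      intro x hx
      have h := sq_mul_sum_sq_le (invSq_mul_sum_coord_sq hx) (fun i => partialD i u x)
      have hS : ∑ i, partialD i u x ^ 2 = gradDot u u x := by
        simp only [gradDot, sq]
      rw [hS] at h
      simp [F, Fin.sum_univ_succ]
      exact h)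
  have i1 := integral_lap_sq hu
  have i2 := integral_eulerD hn0 (hq.mul hq) 2
  have i3 := integral_eulerD hn0 (hu'.gradDot hu') 1
  have i4 := integral_invSq_mul_lap hn0 hq hu
  have i5 := integral_invSq_mul_eulerD_mul_lap hn0 hq hu
  simp only [← sq, eulerD_sq hq, mul_left_comm _ (2 : ℝ), integral_const_mul] at i2
  simp only [eulerD_gradDot_self hu, pow_one, mul_sub, mul_left_comm _ (2 : ℝ)] at i3
  rw [integral_sub ((hq1.gradDot hu1).invSq_mul.integrable.const_mul 2)
    ((hu1.gradDot hu1).invSq_mul.integrable.const_mul 2)] at i3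
  simp only [integral_const_mul] at i3
  simp only [mul_comm (eulerD u _) (eulerD (eulerD u) _)] at i2
  simp only [← sq] at i4
  simp [F, Fin.sum_univ_succ] at hP hQ hR hS
  rw [← i1] at hP
  generalize (∫ x, lap u x ^ 2) = A at *
  generalize (∫ x, invSq x * gradDot u u x) = G at *
  generalize (∫ x, invSq x ^ 2 * eulerD u x ^ 2) = M at *
  generalize (∫ x, invSq x ^ 2 * eulerD (eulerD u) x ^ 2) = N at *
  generalize (∫ x, invSq x * gradDot (eulerD u) (eulerD u) x) = B at *
  generalize (∫ x, invSq x ^ 2 * (eulerD (eulerD u) x * eulerD u x)) = X1 at *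
  generalize (∫ x, invSq x * gradDot (eulerD u) u x) = X2 at *
  generalize (∫ x, invSq x * (eulerD u x * lap u x)) = X3 at *
  generalize (∫ x, invSq x * (eulerD (eulerD u) x * lap u x)) = X4 at *
  rw [ha] at hP i2 i3 i5 ⊢
  have hX1 : X1 = -a * M := by push_cast at i2; linarith
  have hX2 : X2 = -a * G := by push_cast at i3; linarith
  rw [i4, i5, hX1, hX2] at hP
  rw [hX1] at hQ
  rw [hX1, hX2] at hR
  have hQ' : 0 ≤ (2 * a + 2) * (N - a ^ 2 * M) := mul_nonneg (by linarith) (by linarith)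
  have hR' : 0 ≤ (4 * a + 4) * (B - N - a ^ 2 * (G - M)) :=
    mul_nonneg (by linarith) (by linarith)
  have hS' : 0 ≤ (2 * a + 2) * (a ^ 2 + 2 * a - 1) * (G - M) :=
    mul_nonneg (mul_nonneg (by linarith) (by nlinarith)) (by linarith)
  have : 0 ≤ (2 * a + 2) * (A - (2 * a + 4) ^ 2 / 4 * G) := by
    linear_combination hP + hQ' + hR' + hS'
  have := nonneg_of_mul_nonneg_right this (by linarith)
  linarith

section Radial

variable {φ : ℝ → ℝ}

theorem partialD_comp {g : EuclideanSpace ℝ (Fin n) → ℝ} {x : EuclideanSpace ℝ (Fin n)}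
    (hφ : DifferentiableAt ℝ φ (g x)) (hg : DifferentiableAt ℝ g x) (i : Fin n) :
    partialD i (fun y => φ (g y)) x = deriv φ (g x) * partialD i g x := by
  have h : HasFDerivAt (fun y => φ (g y)) (deriv φ (g x) • fderiv ℝ g x) x :=
    hφ.hasDerivAt.comp_hasFDerivAt x hg.hasFDerivAt
  rw [partialD, h.fderiv]
  simp [partialD]

theorem contDiffAt_log_norm_sq {m : WithTop ℕ∞} {x : EuclideanSpace ℝ (Fin n)} (hx : x ≠ 0) :
    ContDiffAt ℝ m (fun y : EuclideanSpace ℝ (Fin n) => Real.log (‖y‖ ^ 2)) x :=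
  (contDiff_norm_sq ℝ).contDiffAt.log (by simpa using hx)

theorem partialD_log_norm_sq {x : EuclideanSpace ℝ (Fin n)} (hx : x ≠ 0) (i : Fin n) :
    partialD i (fun y => Real.log (‖y‖ ^ 2)) x = 2 * (x i * invSq x) := by
  have h1 : HasFDerivAt (fun y : EuclideanSpace ℝ (Fin n) => ‖y‖ ^ 2) (2 • innerSL ℝ x) x :=
    (hasStrictFDerivAt_norm_sq x).hasFDerivAt
  have h3 := h1.log (by simpa using hx)
  rw [partialD, h3.fderiv]
  simp [invSq, EuclideanSpace.inner_single_right]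
  ring

theorem partialD_radial (hφ : ContDiff ℝ 2 φ) {x : EuclideanSpace ℝ (Fin n)} (hx : x ≠ 0)
    (i : Fin n) : partialD i (fun y => φ (Real.log (‖y‖ ^ 2))) x =
      deriv φ (Real.log (‖x‖ ^ 2)) * (2 * (x i * invSq x)) := by
  rw [← partialD_log_norm_sq hx]
  exact partialD_comp (hφ.differentiable (by simp) _)
    ((contDiffAt_log_norm_sq (m := 1) hx).differentiableAt (by simp)) i

theorem gradDot_radial (hφ : ContDiff ℝ 2 φ) {x : EuclideanSpace ℝ (Fin n)} (hx : x ≠ 0) :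
    gradDot (fun y => φ (Real.log (‖y‖ ^ 2))) (fun y => φ (Real.log (‖y‖ ^ 2))) x =
      4 * invSq x * deriv φ (Real.log (‖x‖ ^ 2)) ^ 2 := by
  have hw := invSq_mul_sum_coord_sq hx
  have h : ∀ i, partialD i (fun y => φ (Real.log (‖y‖ ^ 2))) x *
      partialD i (fun y => φ (Real.log (‖y‖ ^ 2))) x =
      4 * invSq x * deriv φ (Real.log (‖x‖ ^ 2)) ^ 2 * (invSq x * x i ^ 2) := by
    intro i
    rw [partialD_radial hφ hx]
    ring
  simp only [gradDot, h, ← Finset.mul_sum, hw, mul_one]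

theorem lap_radial (hφ : ContDiff ℝ 2 φ)
    (hu : ContDiff ℝ 2 fun y : EuclideanSpace ℝ (Fin n) => φ (Real.log (‖y‖ ^ 2)))
    {x : EuclideanSpace ℝ (Fin n)} (hx : x ≠ 0) :
    lap (fun y => φ (Real.log (‖y‖ ^ 2))) x =
      invSq x * (4 * deriv (deriv φ) (Real.log (‖x‖ ^ 2))
        + (2 * n - 4) * deriv φ (Real.log (‖x‖ ^ 2))) := by
  have hw := invSq_mul_sum_coord_sq hx
  have dφ : Differentiable ℝ (deriv φ) :=
    (contDiff_succ_iff_deriv.1 (show ContDiff ℝ (1 + 1) φ from hφ)).2.2.differentiable (by simp)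
  have dL : DifferentiableAt ℝ (fun y : EuclideanSpace ℝ (Fin n) => Real.log (‖y‖ ^ 2)) x :=
    (contDiffAt_log_norm_sq (m := 1) hx).differentiableAt (by simp)
  have dc : DifferentiableAt ℝ
      (fun y : EuclideanSpace ℝ (Fin n) => deriv φ (Real.log (‖y‖ ^ 2))) x :=
    (dφ _).comp x dL
  have h : ∀ i, partialD i (partialD i (fun y => φ (Real.log (‖y‖ ^ 2)))) x =
      4 * invSq x * deriv (deriv φ) (Real.log (‖x‖ ^ 2)) * (invSq x * x i ^ 2)
        + (2 * invSq x * deriv φ (Real.log (‖x‖ ^ 2))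
        - 4 * invSq x * deriv φ (Real.log (‖x‖ ^ 2)) * (invSq x * x i ^ 2)) := by
    intro i
    have he : partialD i (fun y => φ (Real.log (‖y‖ ^ 2))) =ᶠ[𝓝 x]
        fun y => deriv φ (Real.log (‖y‖ ^ 2)) * (2 * (y i * invSq y)) := by
      filter_upwards [isOpen_ne.mem_nhds hx] with y hy
      exact partialD_radial hφ hy i
    have hcw := (differentiableAt_coord i x).fun_mul (differentiableAt_invSq hx)
    rw [partialD, he.fderiv_eq, ← partialD,
      partialD_mul dc (hcw.const_mul 2), partialD_comp (dφ _) dL,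
      partialD_log_norm_sq hx, partialD_mul (differentiableAt_const 2) hcw,
      partialD_mul (differentiableAt_coord i x) (differentiableAt_invSq hx), partialD_coord,
      partialD_invSq hx]
    simp [partialD]
    ring
  rw [lap_eq_sum hu]
  simp only [h, Finset.sum_add_distrib, Finset.sum_sub_distrib, ← Finset.mul_sum, hw]
  simp
  ring

theorem puncturedTest_radial (hφ : ContDiff ℝ 2 φ) (hc : HasCompactSupport φ) (h0 : φ 0 = 0) :
    PuncturedTest 2 fun x : EuclideanSpace ℝ (Fin n) => φ (Real.log (‖x‖ ^ 2)) := by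
  obtain ⟨R, hR0, hR⟩ : ∃ R > 0, ∀ τ, R < |τ| → φ τ = 0 := by
    obtain ⟨R, hR0, hR⟩ := hc.isBounded.exists_pos_norm_le
    exact ⟨R, hR0, fun τ hτ => image_eq_zero_of_notMem_tsupport fun h => hτ.not_ge (hR τ h)⟩
  have near : (fun x : EuclideanSpace ℝ (Fin n) => φ (Real.log (‖x‖ ^ 2))) =ᶠ[𝓝 0] fun _ => 0 := by
    filter_upwards [Metric.ball_mem_nhds (0 : EuclideanSpace ℝ (Fin n)) (Real.exp_pos (-R))]
      with x hx
    by_cases h : x = 0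
    · simpa [h] using h0
    · have hlog : Real.log ‖x‖ < -R := by
        rw [Real.log_lt_iff_lt_exp (norm_pos_iff.2 h)]
        simpa using hx
      refine hR _ (lt_abs.2 (Or.inr ?_))
      rw [Real.log_pow]
      push_cast
      linarith
  refine ⟨contDiff_iff_contDiffAt.2 fun x => ?_, ?_, notMem_tsupport_iff_eventuallyEq.2 near⟩
  · by_cases hx : x = 0
    · rw [hx]
      exact contDiffAt_const.congr_of_eventuallyEq near
    · exact hφ.contDiffAt.comp x (contDiffAt_log_norm_sq hx)
  · refine HasCompactSupport.intro (isCompact_closedBall 0 (Real.exp R)) fun x hx => ?_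
    have hx' : Real.exp R < ‖x‖ := by simpa using hx
    have hlog : R < Real.log ‖x‖ := (Real.lt_log_iff_exp_lt ((Real.exp_pos R).trans hx')).2 hx'
    refine hR _ (lt_abs.2 (Or.inl ?_))
    rw [Real.log_pow]
    push_cast
    linarith

theorem integral_invSq_sq_mul_radial (hn : 4 ≤ n) (Ψ : ℝ → ℝ) :
    ∫ x : EuclideanSpace ℝ (Fin n), invSq x ^ 2 * Ψ (Real.log (‖x‖ ^ 2)) =
      (n * volume.real (Metric.ball (0 : EuclideanSpace ℝ (Fin n)) 1) / 2) *
        ∫ τ, Real.exp ((n - 4) / 2 * τ) * Ψ τ := by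
  have : Nontrivial (EuclideanSpace ℝ (Fin n)) := by
    have : Nonempty (Fin n) := ⟨⟨0, by omega⟩⟩
    infer_instance
  have h1 := integral_fun_norm_addHaar (volume : Measure (EuclideanSpace ℝ (Fin n)))
    (fun r => (r ^ 2)⁻¹ ^ 2 * Ψ (Real.log (r ^ 2)))
  have h2 := integral_image_eq_integral_abs_deriv_smul (s := univ)
    (f := fun t => Real.exp (t / 2)) (f' := fun t => Real.exp (t / 2) * (1 / 2))
    MeasurableSet.univ
    (fun t _ => (((hasDerivAt_id t).div_const 2).exp).hasDerivWithinAt)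
    (fun s _ t _ h => by simpa using h)
    (fun y => y ^ (n - 1) • ((y ^ 2)⁻¹ ^ 2 * Ψ (Real.log (y ^ 2))))
  have himg : (fun t : ℝ => Real.exp (t / 2)) '' univ = Ioi 0 := by
    ext y
    simp only [image_univ, mem_range, mem_Ioi]
    refine ⟨fun ⟨t, ht⟩ => ht ▸ Real.exp_pos _, fun hy => ⟨2 * Real.log y, ?_⟩⟩
    rw [mul_div_cancel_left₀ _ two_ne_zero, Real.exp_log hy]
  rw [himg] at h2
  simp only [finrank_euclideanSpace_fin] at h1
  simp only [invSq]
  rw [setIntegral_univ] at h2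
  suffices h3 : ∫ t, |Real.exp (t / 2) * (1 / 2)| • Real.exp (t / 2) ^ (n - 1) •
      ((Real.exp (t / 2) ^ 2)⁻¹ ^ 2 * Ψ (Real.log (Real.exp (t / 2) ^ 2))) =
      1 / 2 * ∫ τ, Real.exp ((n - 4) / 2 * τ) * Ψ τ by
    rw [h1, h2, h3, nsmul_eq_mul, smul_eq_mul]
    ring
  rw [← integral_const_mul]
  refine integral_congr_ae (Eventually.of_forall fun t => ?_)
  obtain ⟨l, rfl⟩ := Nat.exists_eq_add_of_le hn
  have he : Real.exp ((((4 + l : ℕ) : ℝ) - 4) / 2 * t) = Real.exp (t / 2) ^ l := by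
    rw [← Real.exp_nat_mul]
    push_cast
    ring_nf
  have hl : 4 + l - 1 = l + 3 := by omega
  have hlog : Real.log (Real.exp (t / 2) ^ 2) = t := by
    rw [Real.log_pow, Real.log_exp]
    push_cast
    ring
  simp only [he, hl, hlog, smul_eq_mul, abs_mul, Real.abs_exp]
  have := (Real.exp_pos (t / 2)).ne'
  rw [abs_of_pos (by norm_num : (0 : ℝ) < 1 / 2)]
  field_simp
  ring

theorem deriv_exp_mul {χ : ℝ → ℝ} (hχ : Differentiable ℝ χ) (b : ℝ) :
    deriv (fun τ => Real.exp (b * τ) * χ τ) =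
      fun τ => Real.exp (b * τ) * (deriv χ τ + b * χ τ) := by
  ext τ
  have h : HasDerivAt (fun τ => Real.exp (b * τ)) (Real.exp (b * τ) * (b * 1)) τ :=
    ((hasDerivAt_id τ).const_mul b).exp
  rw [(h.fun_mul (hχ τ).hasDerivAt).deriv]
  ring

/-- The Hardy–Rellich quotient of the radial function `exp (-(n-4)/4 * τ) ψ(ε τ)`,
`τ = log |x|²`, in one-dimensional form. -/
theorem exists_radial_test (hn : 5 ≤ n) {ψ : ℝ → ℝ} (hψ : ContDiff ℝ 2 ψ)
    (hc : HasCompactSupport ψ) (h0 : ψ 0 = 0) {ε : ℝ} (hε : 0 < ε) :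
    ∃ u : EuclideanSpace ℝ (Fin n) → ℝ, PuncturedTest 2 u ∧ ∃ K : ℝ, 0 < K ∧
      (∫ x, lap u x ^ 2) = K * ∫ τ, (4 * ε ^ 2 * deriv (deriv ψ) τ + 4 * ε * deriv ψ τ
        - n * (n - 4) / 4 * ψ τ) ^ 2 ∧
      (∫ x, invSq x * gradDot u u x) = K * ∫ τ, (2 * ε * deriv ψ τ - (n - 4) / 2 * ψ τ) ^ 2 := by
  have hψ' := contDiff_succ_iff_deriv.1 (show ContDiff ℝ (1 + 1) ψ from hψ)
  have dψ : Differentiable ℝ ψ := hψ.differentiable (by simp)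
  have dψ' : Differentiable ℝ (deriv ψ) := hψ'.2.2.differentiable (by simp)
  set b : ℝ := -((n - 4) / 4) with hb
  set φ : ℝ → ℝ := fun τ => Real.exp (b * τ) * ψ (ε * τ) with hφdef
  have d0 : Differentiable ℝ fun τ => ψ (ε * τ) := by fun_prop
  have d1 : Differentiable ℝ fun τ => ε * deriv ψ (ε * τ) := by fun_prop
  have e0 : deriv (fun τ => ψ (ε * τ)) = fun τ => ε * deriv ψ (ε * τ) := by
    ext τ
    simp [deriv_comp_mul_left]
  have e1 : deriv (fun τ => ε * deriv ψ (ε * τ)) = fun τ => ε ^ 2 * deriv (deriv ψ) (ε * τ) := by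
    ext τ
    rw [deriv_const_mul_field, deriv_comp_mul_left, smul_eq_mul]
    ring
  have hφ1 : deriv φ = fun τ => Real.exp (b * τ) * (ε * deriv ψ (ε * τ) + b * ψ (ε * τ)) := by
    rw [hφdef, deriv_exp_mul d0, e0]
  have hφ2 : deriv (deriv φ) = fun τ => Real.exp (b * τ) *
      (ε ^ 2 * deriv (deriv ψ) (ε * τ) + 2 * b * ε * deriv ψ (ε * τ) + b ^ 2 * ψ (ε * τ)) := by
    rw [hφ1, deriv_exp_mul (d1.fun_add (d0.const_mul b))]
    ext τ
    rw [deriv_fun_add (d1 τ) ((d0.const_mul b) τ), e1, deriv_const_mul_field, e0]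
    ring
  have cφ : ContDiff ℝ 2 φ := by
    refine ContDiff.mul (by fun_prop) (hψ.comp (by fun_prop))
  have sφ : HasCompactSupport φ := by
    refine HasCompactSupport.mul_left ?_
    exact hc.comp_homeomorph (Homeomorph.mulLeft₀ ε hε.ne')
  have hu := puncturedTest_radial (n := n) cφ sφ (by simp [hφdef, h0])
  have hexp : ∀ τ : ℝ, Real.exp ((n - 4) / 2 * τ) * Real.exp (b * τ) ^ 2 = 1 := by
    intro τ
    rw [← Real.exp_nat_mul, ← Real.exp_add, hb, Real.exp_eq_one_iff]
    push_cast
    ring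
  set κ := n * volume.real (Metric.ball (0 : EuclideanSpace ℝ (Fin n)) 1) / 2 with hκ
  have hκ0 : 0 < κ := by
    have hn' : (0 : ℝ) < n := by exact_mod_cast (by omega : 0 < n)
    have : 0 < volume.real (Metric.ball (0 : EuclideanSpace ℝ (Fin n)) 1) :=
      ENNReal.toReal_pos (Metric.measure_ball_pos _ _ one_pos).ne' measure_ball_lt_top.ne
    positivity
  refine ⟨_, hu, κ * ε⁻¹, by positivity, ?_, ?_⟩
  · have h1 : ∫ x : EuclideanSpace ℝ (Fin n), lap (fun y => φ (Real.log (‖y‖ ^ 2))) x ^ 2 =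
        ∫ x : EuclideanSpace ℝ (Fin n), invSq x ^ 2 * (4 * deriv (deriv φ) (Real.log (‖x‖ ^ 2))
          + (2 * n - 4) * deriv φ (Real.log (‖x‖ ^ 2))) ^ 2 := by
      refine integral_congr_ae ((ae_ne_zero (by omega)).mono fun x hx => ?_)
      simp only [lap_radial cφ hu.smooth hx]
      ring
    rw [h1, integral_invSq_sq_mul_radial (by omega)
      (fun τ => (4 * deriv (deriv φ) τ + (2 * n - 4) * deriv φ τ) ^ 2), ← hκ, mul_assoc]
    congr 1
    have h2 := Measure.integral_comp_mul_left (fun τ => (4 * ε ^ 2 * deriv (deriv ψ) τ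
      + 4 * ε * deriv ψ τ - n * (n - 4) / 4 * ψ τ) ^ 2) ε
    rw [abs_of_pos (inv_pos.2 hε), smul_eq_mul] at h2
    rw [← h2]
    congr 1
    ext τ
    rw [hφ2, hφ1]
    simp only [hb]
    linear_combination (4 * ε ^ 2 * deriv (deriv ψ) (ε * τ)
      + 4 * ε * deriv ψ (ε * τ) - n * (n - 4) / 4 * ψ (ε * τ)) ^ 2 * hexp τ
  · have h1 : ∫ x : EuclideanSpace ℝ (Fin n), invSq x * gradDot
          (fun y => φ (Real.log (‖y‖ ^ 2))) (fun y => φ (Real.log (‖y‖ ^ 2))) x =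
        ∫ x : EuclideanSpace ℝ (Fin n),
          invSq x ^ 2 * (4 * deriv φ (Real.log (‖x‖ ^ 2)) ^ 2) := by
      refine integral_congr_ae ((ae_ne_zero (by omega)).mono fun x hx => ?_)
      simp only [gradDot_radial cφ hx]
      ring
    rw [h1, integral_invSq_sq_mul_radial (by omega) (fun τ => 4 * deriv φ τ ^ 2), ← hκ, mul_assoc]
    congr 1
    have h2 := Measure.integral_comp_mul_left (fun τ => (2 * ε * deriv ψ τ
      - (n - 4) / 2 * ψ τ) ^ 2) ε
    rw [abs_of_pos (inv_pos.2 hε), smul_eq_mul] at h2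
    rw [← h2]
    congr 1
    ext τ
    rw [hφ1]
    simp only [hb]
    linear_combination (2 * ε * deriv ψ (ε * τ) - (n - 4) / 2 * ψ (ε * τ)) ^ 2 * hexp τ

theorem exists_bump : ∃ ψ : ℝ → ℝ, ContDiff ℝ 2 ψ ∧ HasCompactSupport ψ ∧ ψ 0 = 0 ∧
    0 < ∫ τ, ψ τ ^ 2 := by
  let f : ContDiffBump (2 : ℝ) := ⟨1, 2, one_pos, one_lt_two⟩
  refine ⟨f, f.contDiff, f.hasCompactSupport, f.zero_of_le_dist (by simp [f]), ?_⟩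
  refine Continuous.integral_pos_of_hasCompactSupport_nonneg_nonzero (x := 2)
    (f.continuous.pow 2) ?_ (fun τ => sq_nonneg _) ?_
  · simp only [sq]
    exact f.hasCompactSupport.mul_left
  · rw [f.one_of_mem_closedBall (by simp [f])]
    simp

end Radial

end Punctured

theorem norm_rpow_mul_norm_gradient_sq {n : ℕ} (u : EuclideanSpace ℝ (Fin n) → ℝ)
    (x : EuclideanSpace ℝ (Fin n)) :
    ‖x‖ ^ (-2 : ℝ) * ‖gradient u x‖ ^ 2 = invSq x * gradDot u u x := by
  rw [norm_gradient_sq, invSq, Real.rpow_neg (norm_nonneg x)]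
  norm_num

theorem statement9 (n : ℕ) (hn : 5 ≤ n) :
    sInf {r : ℝ | ∃ u : EuclideanSpace ℝ (Fin n) → ℝ,
        ContDiff ℝ 2 u ∧ HasCompactSupport u ∧
        (0 : EuclideanSpace ℝ (Fin n)) ∉ tsupport u ∧
        (∫ x : EuclideanSpace ℝ (Fin n), ‖x‖ ^ (-2 : ℝ) * ‖gradient u x‖ ^ 2) ≠ 0 ∧
        r = (∫ x : EuclideanSpace ℝ (Fin n), (lap u x) ^ 2) /
            (∫ x : EuclideanSpace ℝ (Fin n), ‖x‖ ^ (-2 : ℝ) * ‖gradient u x‖ ^ 2)} =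
      (n : ℝ) ^ 2 / 4 := by
  simp only [norm_rpow_mul_norm_gradient_sq]
  have lower : ∀ r ∈ {r : ℝ | ∃ u : EuclideanSpace ℝ (Fin n) → ℝ,
        ContDiff ℝ 2 u ∧ HasCompactSupport u ∧
        (0 : EuclideanSpace ℝ (Fin n)) ∉ tsupport u ∧
        (∫ x : EuclideanSpace ℝ (Fin n), invSq x * gradDot u u x) ≠ 0 ∧
        r = (∫ x : EuclideanSpace ℝ (Fin n), (lap u x) ^ 2) /
            (∫ x : EuclideanSpace ℝ (Fin n), invSq x * gradDot u u x)},
      (n : ℝ) ^ 2 / 4 ≤ r := by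
    rintro r ⟨u, hu, hc, h0, hG, rfl⟩
    have hpos : 0 ≤ ∫ x : EuclideanSpace ℝ (Fin n), invSq x * gradDot u u x :=
      integral_nonneg fun x => by
        rw [← norm_rpow_mul_norm_gradient_sq]
        positivity
    rw [le_div_iff₀ (lt_of_le_of_ne hpos hG.symm)]
    exact hardy_rellich hn ⟨hu, hc, h0⟩
  obtain ⟨ψ, hψ, hc, h0, hpos⟩ := exists_bump
  have hψ' := contDiff_succ_iff_deriv.1 (show ContDiff ℝ (1 + 1) ψ from hψ)
  have c0 : Continuous ψ := hψ.continuous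
  have c1 : Continuous (deriv ψ) := hψ'.2.2.continuous
  have c2 : Continuous (deriv (deriv ψ)) := hψ'.2.2.continuous_deriv le_rfl
  have z0 : ∀ τ ∉ tsupport ψ, ψ τ = 0 := fun τ h => image_eq_zero_of_notMem_tsupport h
  have z1 : ∀ τ ∉ tsupport ψ, deriv ψ τ = 0 := fun τ h =>
    image_eq_zero_of_notMem_tsupport fun h' => h (tsupport_deriv_subset h')
  have z2 : ∀ τ ∉ tsupport ψ, deriv (deriv ψ) τ = 0 := fun τ h =>
    image_eq_zero_of_notMem_tsupport fun h' =>
      h (tsupport_deriv_subset (tsupport_deriv_subset h'))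
  set P : ℝ → ℝ := fun ε => ∫ τ, (4 * ε ^ 2 * deriv (deriv ψ) τ + 4 * ε * deriv ψ τ
        - n * (n - 4) / 4 * ψ τ) ^ 2 with hP
  set Q : ℝ → ℝ := fun ε => ∫ τ, (2 * ε * deriv ψ τ - (n - 4) / 2 * ψ τ) ^ 2 with hQ
  have cP : Continuous P := by
    rw [← continuousOn_univ]
    refine continuousOn_integral_of_compact_support hc ?_ fun ε τ _ h => ?_
    · unfold Function.uncurry
      fun_prop
    · simp [z0 τ h, z1 τ h, z2 τ h]
  have cQ : Continuous Q := by
    rw [← continuousOn_univ]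
    refine continuousOn_integral_of_compact_support hc ?_ fun ε τ _ h => ?_
    · unfold Function.uncurry
      fun_prop
    · simp [z0 τ h, z1 τ h]
  have hn4 : (0 : ℝ) < n - 4 := by
    have : (5 : ℝ) ≤ n := by exact_mod_cast hn
    linarith
  have hP0 : P 0 = (n * (n - 4) / 4) ^ 2 * ∫ τ, ψ τ ^ 2 := by
    simp [hP, mul_pow, integral_const_mul]
  have hQ0 : Q 0 = ((n - 4) / 2) ^ 2 * ∫ τ, ψ τ ^ 2 := by
    simp [hQ, mul_pow, integral_const_mul]
  have hQpos : 0 < Q 0 := by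
    rw [hQ0]
    positivity
  have hlim : Tendsto (fun ε => P ε / Q ε) (𝓝[>] 0) (𝓝 ((n : ℝ) ^ 2 / 4)) := by
    have h := (cP.continuousAt.div cQ.continuousAt hQpos.ne').tendsto (x := (0 : ℝ))
    have e : P 0 / Q 0 = (n : ℝ) ^ 2 / 4 := by
      rw [hP0, hQ0]
      field_simp
      ring
    rw [← e]
    exact h.mono_left nhdsWithin_le_nhds
  have hmem : ∀ᶠ ε in 𝓝[>] (0 : ℝ), P ε / Q ε ∈ {r : ℝ | ∃ u : EuclideanSpace ℝ (Fin n) → ℝ,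
        ContDiff ℝ 2 u ∧ HasCompactSupport u ∧
        (0 : EuclideanSpace ℝ (Fin n)) ∉ tsupport u ∧
        (∫ x : EuclideanSpace ℝ (Fin n), invSq x * gradDot u u x) ≠ 0 ∧
        r = (∫ x : EuclideanSpace ℝ (Fin n), (lap u x) ^ 2) /
            (∫ x : EuclideanSpace ℝ (Fin n), invSq x * gradDot u u x)} := by
    filter_upwards [self_mem_nhdsWithin, nhdsWithin_le_nhds
      (cQ.continuousAt.eventually_ne hQpos.ne')] with ε hε hne
    obtain ⟨u, hu, K, hK, hA, hG⟩ := exists_radial_test hn hψ hc h0 hε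
    refine ⟨u, hu.smooth, hu.compact, hu.zero_notMem, ?_, ?_⟩
    · rw [hG]
      exact mul_ne_zero hK.ne' hne
    · rw [hA, hG, mul_div_mul_left _ _ hK.ne']
  refine le_antisymm ?_ (le_csInf ?_ lower)
  · exact ge_of_tendsto hlim (hmem.mono fun ε h => csInf_le ⟨_, lower⟩ h)
  · obtain ⟨ε, h⟩ := hmem.exists
    exact ⟨_, h⟩
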